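/- arXiv:2201.04164 — 2 statements merged into one kernel-verified Lean document; each statement's English description precedes it below -/
import Mathlib

section
/- Let G be a finite simple graph, W a minimal vertex cover of G, and let f = ∏_{y ∉ W} X(y,0) be the product of the 0-th jet variables of the vertices outside W. Then ⟨J_s(W)⟩ = J_s(I(G)) : f^{s+1}; that is, an element g ∈ J_sR satisfies g · f^{s+1} ∈ J_s(I(G)) if and only if g ∈ ⟨J_s(W)⟩. -/
open MvPolynomial

/-- `W` is a vertex cover of `G`. -/
def IsVertexCover {V : Type*} (G : SimpleGraph V) (W : Set V) : Prop :=
  ∀ ⦃x y : V⦄, G.Adj x y → x ∈ W ∨ y ∈ W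

/-- `W` is a minimal vertex cover of `G`. -/
def IsMinimalVertexCover {V : Type*} (G : SimpleGraph V) (W : Set V) : Prop :=
  IsVertexCover G W ∧ ∀ W' : Set V, W' ⊂ W → ¬ IsVertexCover G W'

/-- The degree `m` part `α_m(x,y) = ∑_{i+j=m} X(x,i)·X(y,j)` of the image of the
edge monomial `xy` in the ring of `s`-jets. -/
noncomputable def jetsAlpha (k : Type*) [Field k] {V : Type*} (s : ℕ) (x y : V) (m : ℕ) :
    MvPolynomial (V × Fin (s + 1)) k :=
  ∑ ij ∈ Finset.univ.filter
      (fun ij : Fin (s + 1) × Fin (s + 1) => (ij.1 : ℕ) + (ij.2 : ℕ) = m),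
    X (x, ij.1) * X (y, ij.2)

/-- The `s`-jets `J_s(I(G))` of the edge ideal of `G`. -/
noncomputable def jetsEdgeIdeal (k : Type*) [Field k] {V : Type*} (G : SimpleGraph V)
    (s : ℕ) : Ideal (MvPolynomial (V × Fin (s + 1)) k) :=
  Ideal.span {f | ∃ x y : V, G.Adj x y ∧ ∃ m ≤ s, f = jetsAlpha k s x y m}

/-- `⟨J_s(W)⟩`: the ideal generated by the jets variables of the elements of `W`. -/
noncomputable def jetsVertexCoverIdeal (k : Type*) [Field k] {V : Type*} (s : ℕ)
    (W : Set V) : Ideal (MvPolynomial (V × Fin (s + 1)) k) :=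
  Ideal.span {f | ∃ x ∈ W, ∃ i : Fin (s + 1), f = X (x, i)}

/-- Every element of a minimal vertex cover has a neighbour outside the cover. -/
theorem IsMinimalVertexCover.exists_adj_notMem {V : Type*} {G : SimpleGraph V} {W : Set V}
    (hW : IsMinimalVertexCover G W) {x : V} (hx : x ∈ W) : ∃ y, y ∉ W ∧ G.Adj x y := by
  by_contra! h
  refine hW.2 (W \ {x}) ⟨Set.sdiff_subset, fun hsub => (hsub hx).2 rfl⟩ fun a b hab => ?_
  by_cases ha : a = x
  · subst ha
    refine Or.inr ⟨?_, hab.ne'⟩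
    by_contra hb
    exact h b hb hab
  by_cases hb : b = x
  · subst hb
    refine Or.inl ⟨?_, hab.ne⟩
    by_contra ha'
    exact h a ha' hab.symm
  · exact (hW.1 hab).imp (⟨·, ha⟩) (⟨·, hb⟩)

theorem jetsAlpha_mem_jetsEdgeIdeal (k : Type*) [Field k] {V : Type*} {G : SimpleGraph V}
    {s : ℕ} {x y : V} (h : G.Adj x y) {m : ℕ} (hm : m ≤ s) :
    jetsAlpha k s x y m ∈ jetsEdgeIdeal k G s :=
  Ideal.subset_span ⟨x, y, h, m, hm, rfl⟩

theorem X_mul_X_zero_pow_mem_jetsEdgeIdeal (k : Type*) [Field k] {V : Type*}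
    {G : SimpleGraph V} {s : ℕ} {x y : V} (h : G.Adj x y) (i : Fin (s + 1)) :
    X (x, i) * X (y, 0) ^ (s + 1) ∈ jetsEdgeIdeal k G s := by
  suffices H : ∀ n (hn : n < s + 1),
      X (x, ⟨n, hn⟩) * X (y, 0) ^ (n + 1) ∈ jetsEdgeIdeal k G s by
    obtain ⟨n, hn⟩ := i
    have := Ideal.mul_mem_right (X (y, 0) ^ (s - n)) _ (H n hn)
    rwa [mul_assoc, ← pow_add, show n + 1 + (s - n) = s + 1 by lia] at this
  intro n
  induction n using Nat.strong_induction_on with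
  | _ n ih =>
    intro hn
    have hα := Ideal.mul_mem_right (X (y, 0) ^ n) _
      (jetsAlpha_mem_jetsEdgeIdeal k h (Nat.lt_succ_iff.mp hn))
    have hmem : ((⟨n, hn⟩, 0) : Fin (s + 1) × Fin (s + 1)) ∈ Finset.univ.filter
        (fun ij : Fin (s + 1) × Fin (s + 1) => (ij.1 : ℕ) + (ij.2 : ℕ) = n) := by simp
    rw [jetsAlpha, ← Finset.add_sum_erase _ _ hmem, add_mul] at hα
    rw [pow_succ', ← mul_assoc]
    refine (Ideal.add_mem_iff_left _ ?_).mp hα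
    rw [Finset.sum_mul]
    refine Ideal.sum_mem _ fun ij hij => ?_
    obtain ⟨⟨j, hj⟩, ⟨l, hl⟩⟩ := ij
    simp only [Finset.mem_erase, Finset.mem_filter, Finset.mem_univ, true_and, ne_eq,
      Prod.mk.injEq, Fin.ext_iff, Fin.val_zero] at hij
    have hjn : j < n := by lia
    have := Ideal.mul_mem_left _ (X (y, ⟨l, hl⟩) * X (y, 0) ^ (n - (j + 1))) (ih j hjn hj)
    convert this using 1
    rw [show n = n - (j + 1) + (j + 1) by lia, pow_add, Nat.add_sub_cancel]
    ring

theorem jetsEdgeIdeal_le_jetsVertexCoverIdeal (k : Type*) [Field k] {V : Type*}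
    {G : SimpleGraph V} (s : ℕ) {W : Set V} (hW : IsVertexCover G W) :
    jetsEdgeIdeal k G s ≤ jetsVertexCoverIdeal k s W := by
  refine Ideal.span_le.mpr ?_
  rintro _ ⟨x, y, hxy, m, -, rfl⟩
  refine Ideal.sum_mem _ fun ij _ => ?_
  rcases hW hxy with hx | hy
  · exact Ideal.mul_mem_right _ _ (Ideal.subset_span ⟨x, hx, ij.1, rfl⟩)
  · exact Ideal.mul_mem_left _ _ (Ideal.subset_span ⟨y, hy, ij.2, rfl⟩)

/-- The substitution sending the jets variables of `W` to zero. -/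
noncomputable def jetsKill (k : Type*) [Field k] {V : Type*} (s : ℕ) (W : Set V)
    [DecidablePred (· ∈ W)] :
    MvPolynomial (V × Fin (s + 1)) k →ₐ[k] MvPolynomial (V × Fin (s + 1)) k :=
  aeval fun p => if p.1 ∈ W then 0 else X p

theorem ker_jetsKill (k : Type*) [Field k] {V : Type*} (s : ℕ) (W : Set V)
    [DecidablePred (· ∈ W)] :
    RingHom.ker (jetsKill k s W) = jetsVertexCoverIdeal k s W := by
  refine le_antisymm (fun g hg => ?_) (Ideal.span_le.mpr ?_)
  · have hcomp : (Ideal.Quotient.mkₐ k (jetsVertexCoverIdeal k s W)).comp (jetsKill k s W) =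
        Ideal.Quotient.mkₐ k (jetsVertexCoverIdeal k s W) := by
      refine algHom_ext fun p => ?_
      by_cases hp : p.1 ∈ W
      · have hX : X p ∈ jetsVertexCoverIdeal k s W :=
          Ideal.subset_span ⟨p.1, hp, p.2, rfl⟩
        simp [jetsKill, hp, Ideal.Quotient.eq_zero_iff_mem.mpr hX]
      · simp [jetsKill, hp]
    have := DFunLike.congr_fun hcomp g
    rw [AlgHom.comp_apply, (RingHom.mem_ker).mp hg, map_zero] at this
    exact Ideal.Quotient.eq_zero_iff_mem.mp this.symm
  · rintro _ ⟨x, hx, i, rfl⟩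
    simp [jetsKill, hx]

theorem jetsVertexCoverIdeal_eq_colon (k : Type*) [Field k] {V : Type*} [Fintype V]
    (G : SimpleGraph V) (s : ℕ) (W : Set V) [DecidablePred (· ∈ W)]
    (hW : IsMinimalVertexCover G W)
    (f : MvPolynomial (V × Fin (s + 1)) k)
    (hf : f = ∏ y ∈ Finset.univ.filter (fun y : V => y ∉ W), X (y, (0 : Fin (s + 1)))) :
    jetsVertexCoverIdeal k s W =
      (jetsEdgeIdeal k G s).colon (Ideal.span {f ^ (s + 1)}) ∧
    ∀ g : MvPolynomial (V × Fin (s + 1)) k,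
      g * f ^ (s + 1) ∈ jetsEdgeIdeal k G s ↔ g ∈ jetsVertexCoverIdeal k s W := by
  have key : ∀ g : MvPolynomial (V × Fin (s + 1)) k,
      g * f ^ (s + 1) ∈ jetsEdgeIdeal k G s ↔ g ∈ jetsVertexCoverIdeal k s W := by
    refine fun g => ⟨fun hg => ?_, fun hg => ?_⟩
    · have hker := jetsEdgeIdeal_le_jetsVertexCoverIdeal k s hW.1 hg
      have hfix : jetsKill k s W f = f := by
        rw [hf, map_prod]
        refine Finset.prod_congr rfl fun y hy => ?_
        simp [jetsKill, (Finset.mem_filter.mp hy).2]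
      have hf0 : f ≠ 0 := hf ▸ Finset.prod_ne_zero_iff.mpr fun y _ => X_ne_zero _
      rw [← ker_jetsKill, RingHom.mem_ker, map_mul, map_pow, hfix] at hker
      rw [← ker_jetsKill, RingHom.mem_ker]
      exact (mul_eq_zero.mp hker).resolve_right (pow_ne_zero _ hf0)
    · refine Submodule.span_induction ?_ (by simp) (fun a b _ _ ha hb => ?_)
        (fun a b _ hb => ?_) hg
      · rintro _ ⟨x, hx, i, rfl⟩
        obtain ⟨y, hy, hxy⟩ := hW.exists_adj_notMem hx
        have hdvd : X (y, 0) ∣ f := hf ▸ Finset.dvd_prod_of_mem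
          (fun y => (X (y, 0) : MvPolynomial (V × Fin (s + 1)) k)) (by simpa using hy)
        exact Ideal.mem_of_dvd _ (mul_dvd_mul_left _ (pow_dvd_pow_of_dvd hdvd _))
          (X_mul_X_zero_pow_mem_jetsEdgeIdeal k hxy i)
      · rw [add_mul]
        exact Ideal.add_mem _ ha hb
      · rw [smul_eq_mul, mul_assoc]
        exact Ideal.mul_mem_left _ _ hb
  refine ⟨Ideal.ext fun g => ?_, key⟩
  rw [Ideal.mem_colon_span_singleton, key]
end

section
/- Let G be a finite simple graph. The intersection, over all minimal vertex covers W of G, of the ideals ⟨J_s(W)⟩ equals the ideal of J_sR generated by all products X(x,i) · X(y,j) where {x,y} is an edge of G and 0 ≤ i, j ≤ s: ⋂_{W minimal vertex cover of G} ⟨J_s(W)⟩ = ⟨ X(x,i)·X(y,j) : {x,y} ∈ E(G), 0 ≤ i,j ≤ s ⟩. -/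
open MvPolynomial

theorem IsVertexCover.exists_isMinimalVertexCover_subset {V : Type*} [Finite V]
    {G : SimpleGraph V} {C : Set V} (hC : IsVertexCover G C) :
    ∃ W ⊆ C, IsMinimalVertexCover G W := by
  obtain ⟨W, hWC, hW⟩ := exists_minimal_le_of_wellFoundedLT (IsVertexCover G) C hC
  exact ⟨W, hWC, hW.prop, fun W' hW' h => hW.not_prop_of_lt hW' h⟩

theorem mem_jetsVertexCoverIdeal {k : Type*} [Field k] {V : Type*} {s : ℕ} {W : Set V}
    {p : MvPolynomial (V × Fin (s + 1)) k} :
    p ∈ jetsVertexCoverIdeal k s W ↔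
      ∀ m ∈ p.support, ∃ x ∈ W, ∃ i, m (x, i) ≠ 0 := by
  have h : {f : MvPolynomial (V × Fin (s + 1)) k | ∃ x ∈ W, ∃ i : Fin (s + 1), f = X (x, i)} =
      X '' {v | v.1 ∈ W} := by
    ext f
    simp [eq_comm]
  rw [jetsVertexCoverIdeal, h, mem_ideal_span_X_image]
  simp

/-- Membership in the ideal generated by the products of variables over adjacent vertices. -/
theorem mem_span_adj_X_mul_X {k : Type*} [Field k] {V : Type*} {G : SimpleGraph V} {s : ℕ}
    {p : MvPolynomial (V × Fin (s + 1)) k} :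
    p ∈ Ideal.span {f : MvPolynomial (V × Fin (s + 1)) k |
        ∃ x y : V, G.Adj x y ∧ ∃ i j : Fin (s + 1), f = X (x, i) * X (y, j)} ↔
      ∀ m ∈ p.support, ∃ x y, G.Adj x y ∧ (∃ i, m (x, i) ≠ 0) ∧ ∃ j, m (y, j) ≠ 0 := by
  classical
  have h : {f : MvPolynomial (V × Fin (s + 1)) k |
        ∃ x y : V, G.Adj x y ∧ ∃ i j : Fin (s + 1), f = X (x, i) * X (y, j)} =
      (fun m => monomial m (1 : k)) '' {m | ∃ x y : V, G.Adj x y ∧ ∃ i j : Fin (s + 1),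
        m = Finsupp.single (x, i) 1 + Finsupp.single (y, j) 1} := by
    ext f
    constructor
    · rintro ⟨x, y, hxy, i, j, rfl⟩
      exact ⟨_, ⟨x, y, hxy, i, j, rfl⟩, by simp [X, monomial_mul]⟩
    · rintro ⟨_, ⟨x, y, hxy, i, j, rfl⟩, rfl⟩
      exact ⟨x, y, hxy, i, j, by simp [X, monomial_mul]⟩
  rw [h, mem_ideal_span_monomial_image]
  refine forall₂_congr fun m _ => ⟨?_, ?_⟩
  · rintro ⟨_, ⟨x, y, hxy, i, j, rfl⟩, hm⟩
    refine ⟨x, y, hxy, ⟨i, ?_⟩, ⟨j, ?_⟩⟩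
    · have := hm (x, i)
      simp only [Finsupp.add_apply, Finsupp.single_eq_same] at this
      lia
    · have := hm (y, j)
      simp only [Finsupp.add_apply, Finsupp.single_eq_same] at this
      lia
  · rintro ⟨x, y, hxy, ⟨i, hi⟩, ⟨j, hj⟩⟩
    refine ⟨_, ⟨x, y, hxy, i, j, rfl⟩, fun v => ?_⟩
    have hne : (x, i) ≠ (y, j) := fun h => hxy.ne (congrArg Prod.fst h)
    simp only [Finsupp.add_apply, Finsupp.single_apply]
    grind

theorem iInf_jetsVertexCoverIdeal_eq_principalComponent (k : Type*) [Field k]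
    {V : Type*} [Fintype V] (G : SimpleGraph V) (s : ℕ) :
    ⨅ W ∈ {W : Set V | IsMinimalVertexCover G W}, jetsVertexCoverIdeal k s W =
      Ideal.span {f : MvPolynomial (V × Fin (s + 1)) k |
        ∃ x y : V, G.Adj x y ∧ ∃ i j : Fin (s + 1), f = X (x, i) * X (y, j)} := by
  ext p
  simp only [Set.mem_ofPred_eq, Submodule.mem_iInf, mem_jetsVertexCoverIdeal,
    mem_span_adj_X_mul_X]
  constructor
  · intro hp m hm
    by_contra! hG
    have hcover : IsVertexCover G {x | ∀ i, m (x, i) = 0} := by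
      intro x y hxy
      by_contra! h
      simp only [Set.mem_ofPred_eq, not_forall] at h
      obtain ⟨⟨i, hi⟩, j, hj⟩ := h
      exact hj (hG x y hxy ⟨i, hi⟩ j)
    obtain ⟨W, hWC, hW⟩ := hcover.exists_isMinimalVertexCover_subset
    obtain ⟨x, hx, i, hi⟩ := hp W hW m hm
    exact hi (hWC hx i)
  · intro hp W hW m hm
    obtain ⟨x, y, hxy, hx, hy⟩ := hp m hm
    rcases hW.1 hxy with h | h
    · exact ⟨x, h, hx⟩
    · exact ⟨y, h, hy⟩
end
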